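/- Let n ≥ 1, 0 < β < 1, 0 < α < n with α + β < n, 0 < t < ∞, 1 < p < r < ∞ and 1 < q < s < ∞ satisfy (α+β)/n = 1/p − 1/r = 1/q − 1/s. Let Ω be homogeneous of degree zero, have mean value zero on S^{n−1}, and suppose in addition that Ω is infinitely differentiable on an open subset of S^{n−1} on which it has no zeros. If b is locally integrable and the commutator [b, T_{Ω,α}] is bounded from (E_p^q)_t(ℝ^n) to (E_r^s)_t(ℝ^n), i.e. there is C₀ with ‖[b, T_{Ω,α}]f‖_{(E_r^s)_t} ≤ C₀ ‖f‖_{(E_p^q)_t} for all f ∈ (E_p^q)_t(ℝ^n), then b ∈ Lip_β(ℝ^n); in particular sup_Q |Q|^{−1−β/n} ∫_Q |b(x) − b_Q| dx ≤ C C₀ for a constant C independent of b, the supremum being over all cubes Q. -/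

import Mathlib

open MeasureTheory ENNReal Metric

noncomputable section

/-- The (closed) cube centered at `x` with side length `r`. -/
def cube {n : ℕ} (x : EuclideanSpace ℝ (Fin n)) (r : ℝ) : Set (EuclideanSpace ℝ (Fin n)) :=
  {y | ∀ i, |y i - x i| ≤ r / 2}

/-- The average `f_Q = |Q|⁻¹ ∫_Q f` of `f` over a set `Q`. -/
def setAvg {n : ℕ} (Q : Set (EuclideanSpace ℝ (Fin n))) (f : EuclideanSpace ℝ (Fin n) → ℝ) : ℝ :=
  (volume Q).toReal⁻¹ * ∫ y in Q, f y

/-- Slice norm of an `ℝ≥0∞`-valued function. -/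
def sliceNormE {n : ℕ} (p q t : ℝ) (g : EuclideanSpace ℝ (Fin n) → ℝ≥0∞) : ℝ≥0∞ :=
  (∫⁻ x, ((volume (cube x t))⁻¹ * ∫⁻ y in cube x t, g y ^ p) ^ (q / p)) ^ (1 / q)

/-- The slice space norm `‖f‖_{(E_p^q)_t}`. -/
def sliceNorm {n : ℕ} (p q t : ℝ) (f : EuclideanSpace ℝ (Fin n) → ℝ) : ℝ≥0∞ :=
  sliceNormE p q t fun y => ENNReal.ofReal |f y|

/-- Membership in the slice space `(E_p^q)_t(ℝⁿ)`. -/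
def MemSlice {n : ℕ} (p q t : ℝ) (f : EuclideanSpace ℝ (Fin n) → ℝ) : Prop :=
  Measurable f ∧ sliceNorm p q t f ≠ ∞

/-- The BMO seminorm, as a supremum over all cubes. -/
def bmoNorm {n : ℕ} (b : EuclideanSpace ℝ (Fin n) → ℝ) : ℝ≥0∞ :=
  ⨆ (x : EuclideanSpace ℝ (Fin n)) (r : ℝ) (_ : 0 < r),
    (volume (cube x r))⁻¹ * ∫⁻ y in cube x r, ENNReal.ofReal |b y - setAvg (cube x r) b|

/-- Membership in `BMO(ℝⁿ)`. -/
def MemBMO {n : ℕ} (b : EuclideanSpace ℝ (Fin n) → ℝ) : Prop :=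
  LocallyIntegrable b volume ∧ bmoNorm b ≠ ∞

/-- `Ω` is homogeneous of degree zero. -/
def HomogZero {n : ℕ} (Ω : EuclideanSpace ℝ (Fin n) → ℝ) : Prop :=
  ∀ lam : ℝ, 0 < lam → ∀ x : EuclideanSpace ℝ (Fin n), x ≠ 0 → Ω (lam • x) = Ω x

/-- `Ω` has mean value zero on the unit sphere. -/
def MeanZeroOnSphere {n : ℕ} (Ω : EuclideanSpace ℝ (Fin n) → ℝ) : Prop :=
  ∫ x : sphere (0 : EuclideanSpace ℝ (Fin n)) 1, Ω x
    ∂((volume : Measure (EuclideanSpace ℝ (Fin n))).toSphere) = 0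

/-- The fractional integral operator with rough kernel,
`T_{Ω,α} f (x) = ∫ Ω(x-y) |x-y|^{α-n} f(y) dy`. -/
def fracInt {n : ℕ} (Ω : EuclideanSpace ℝ (Fin n) → ℝ) (α : ℝ)
    (f : EuclideanSpace ℝ (Fin n) → ℝ) (x : EuclideanSpace ℝ (Fin n)) : ℝ :=
  ∫ y, Ω (x - y) * ‖x - y‖ ^ (α - n) * f y

/-- The commutator `[b, T_{Ω,α}] f = b ⬝ T_{Ω,α} f - T_{Ω,α}(b f)`. -/
def commutatorOp {n : ℕ} (Ω : EuclideanSpace ℝ (Fin n) → ℝ) (α : ℝ)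
    (b f : EuclideanSpace ℝ (Fin n) → ℝ) : EuclideanSpace ℝ (Fin n) → ℝ :=
  fun x => b x * fracInt Ω α f x - fracInt Ω α (fun y => b y * f y) x

/-- The fractional maximal operator `M_γ` (over cubes); `γ = 0` gives the
Hardy–Littlewood maximal operator. -/
def fracMax {n : ℕ} (γ : ℝ) (f : EuclideanSpace ℝ (Fin n) → ℝ)
    (x : EuclideanSpace ℝ (Fin n)) : ℝ≥0∞ :=
  ⨆ (z : EuclideanSpace ℝ (Fin n)) (r : ℝ) (_ : 0 < r) (_ : x ∈ cube z r),
    volume (cube z r) ^ (γ / n - 1) * ∫⁻ y in cube z r, ENNReal.ofReal |f y|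

/-- The Fefferman–Stein sharp maximal operator `M^♯`. -/
def sharpMax {n : ℕ} (f : EuclideanSpace ℝ (Fin n) → ℝ)
    (x : EuclideanSpace ℝ (Fin n)) : ℝ≥0∞ :=
  ⨆ (z : EuclideanSpace ℝ (Fin n)) (r : ℝ) (_ : 0 < r) (_ : x ∈ cube z r),
    (volume (cube z r))⁻¹ * ∫⁻ y in cube z r, ENNReal.ofReal |f y - setAvg (cube z r) f|

/-- The `L^p` norm. -/
def lpNorm {n : ℕ} (p : ℝ) (f : EuclideanSpace ℝ (Fin n) → ℝ) : ℝ≥0∞ :=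
  (∫⁻ x, ENNReal.ofReal |f x| ^ p) ^ (1 / p)

/-- The set of admissible Hölder–Lipschitz constants of order `β` for `b`. -/
def LipConstSet {n : ℕ} (β : ℝ) (b : EuclideanSpace ℝ (Fin n) → ℝ) : Set ℝ :=
  {C : ℝ | ∀ x y, |b x - b y| ≤ C * dist x y ^ β}

/-- Membership in the Lipschitz space `Lip_β(ℝⁿ)`. -/
def MemLip {n : ℕ} (β : ℝ) (b : EuclideanSpace ℝ (Fin n) → ℝ) : Prop :=
  (LipConstSet β b).Nonempty

/-- The `Lip_β` norm: the least admissible constant. -/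
def lipNorm {n : ℕ} (β : ℝ) (b : EuclideanSpace ℝ (Fin n) → ℝ) : ℝ :=
  sInf (LipConstSet β b)

section Cubes

variable {n : ℕ}

lemma cube_eq_preimage (x : EuclideanSpace ℝ (Fin n)) (r : ℝ) :
    cube x r = WithLp.ofLp ⁻¹' Set.Icc (fun i => x i - r / 2) (fun i => x i + r / 2) := by
  ext y
  simp only [cube, Set.mem_ofPred_eq, Set.mem_preimage, Set.mem_Icc, Pi.le_def, abs_le,
    ← forall_and]
  refine forall_congr' fun i => ?_
  constructor <;> rintro ⟨h1, h2⟩ <;> constructor <;> linarith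

lemma isClosed_cube (x : EuclideanSpace ℝ (Fin n)) (r : ℝ) : IsClosed (cube x r) := by
  rw [cube_eq_preimage]
  exact isClosed_Icc.preimage (by fun_prop)

lemma measurableSet_cube (x : EuclideanSpace ℝ (Fin n)) (r : ℝ) : MeasurableSet (cube x r) :=
  (isClosed_cube x r).measurableSet

lemma volume_cube (x : EuclideanSpace ℝ (Fin n)) {r : ℝ} (hr : 0 ≤ r) :
    volume (cube x r) = ENNReal.ofReal (r ^ n) := by
  rw [cube_eq_preimage,
    (PiLp.volume_preserving_ofLp (Fin n)).measure_preimage measurableSet_Icc.nullMeasurableSet,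
    Real.volume_Icc_pi]
  have : ∀ i : Fin n, x i + r / 2 - (x i - r / 2) = r := fun i => by ring
  simp [this, ENNReal.ofReal_pow hr]

lemma volume_cube_ne_zero (x : EuclideanSpace ℝ (Fin n)) {r : ℝ} (hr : 0 < r) :
    volume (cube x r) ≠ 0 := by
  rw [volume_cube x hr.le]
  simpa using pow_pos hr n

lemma volume_cube_ne_top (x : EuclideanSpace ℝ (Fin n)) {r : ℝ} (hr : 0 ≤ r) :
    volume (cube x r) ≠ ∞ := by
  rw [volume_cube x hr]
  exact ENNReal.ofReal_ne_top

lemma mem_cube_comm {x y : EuclideanSpace ℝ (Fin n)} {r : ℝ} : y ∈ cube x r ↔ x ∈ cube y r := by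
  simp only [cube, Set.mem_ofPred_eq, abs_sub_comm]

lemma cube_subset_cube {x y : EuclideanSpace ℝ (Fin n)} {r R d : ℝ}
    (hd : ∀ i, |y i - x i| ≤ d) (hR : r / 2 + d ≤ R / 2) : cube y r ⊆ cube x R := by
  intro z hz i
  calc |z i - x i| ≤ |z i - y i| + |y i - x i| := abs_sub_le _ _ _
    _ ≤ r / 2 + d := add_le_add (hz i) (hd i)
    _ ≤ R / 2 := hR

lemma cube_mono (x : EuclideanSpace ℝ (Fin n)) {r R : ℝ} (h : r ≤ R) : cube x r ⊆ cube x R :=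
  fun _ hz i => (hz i).trans (by linarith)

lemma abs_sub_apply_le_dist (x y : EuclideanSpace ℝ (Fin n)) (i : Fin n) :
    |y i - x i| ≤ dist x y := by
  rw [dist_comm, dist_eq_norm]
  exact PiLp.norm_apply_le (y - x) i

lemma closedBall_subset_cube (x : EuclideanSpace ℝ (Fin n)) (r : ℝ) :
    closedBall x (r / 2) ⊆ cube x r := by
  intro y hy i
  rw [mem_closedBall'] at hy
  exact (abs_sub_apply_le_dist x y i).trans hy

lemma norm_le_of_forall_abs_le {w : EuclideanSpace ℝ (Fin n)} {c : ℝ} (hc : 0 ≤ c)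
    (h : ∀ i, |w i| ≤ c) : ‖w‖ ≤ n * c := by
  rw [EuclideanSpace.norm_eq, Real.sqrt_le_iff]
  refine ⟨by positivity, ?_⟩
  have hn : (n : ℝ) ≤ (n : ℝ) ^ 2 := by exact_mod_cast Nat.le_self_pow two_ne_zero n
  calc ∑ i, ‖w i‖ ^ 2 ≤ ∑ _i : Fin n, c ^ 2 := by
        gcongr with i
        exact h i
    _ = n * c ^ 2 := by simp
    _ ≤ (n : ℝ) ^ 2 * c ^ 2 := by gcongr
    _ = (n * c) ^ 2 := by ring

lemma isCompact_cube (x : EuclideanSpace ℝ (Fin n)) {r : ℝ} (hr : 0 ≤ r) :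
    IsCompact (cube x r) := by
  refine (isCompact_closedBall x (n * (r / 2))).of_isClosed_subset (isClosed_cube x r) ?_
  intro y hy
  rw [mem_closedBall, dist_eq_norm]
  exact norm_le_of_forall_abs_le (by positivity) hy

lemma measurableSet_setOf_mem_cube (t : ℝ) :
    MeasurableSet {z : EuclideanSpace ℝ (Fin n) × EuclideanSpace ℝ (Fin n) | z.2 ∈ cube z.1 t} := by
  have : {z : EuclideanSpace ℝ (Fin n) × EuclideanSpace ℝ (Fin n) | z.2 ∈ cube z.1 t} =
      ⋂ i, {z | |z.2 i - z.1 i| ≤ t / 2} := by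
    ext z
    simp [cube]
  rw [this]
  refine MeasurableSet.iInter fun i => (isClosed_le ?_ continuous_const).measurableSet
  fun_prop

end Cubes

section SliceNorms

variable {n : ℕ}

lemma setLIntegral_cube_eq (t : ℝ) (h : EuclideanSpace ℝ (Fin n) → ℝ≥0∞)
    (x : EuclideanSpace ℝ (Fin n)) :
    ∫⁻ y in cube x t, h y = ∫⁻ y, {z : EuclideanSpace ℝ (Fin n) × EuclideanSpace ℝ (Fin n) |
      z.2 ∈ cube z.1 t}.indicator (fun z => h z.2) (x, y) := by
  rw [← lintegral_indicator (measurableSet_cube x t)]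
  rfl

lemma measurable_setLIntegral_cube (t : ℝ) {h : EuclideanSpace ℝ (Fin n) → ℝ≥0∞}
    (hh : Measurable h) : Measurable fun x => ∫⁻ y in cube x t, h y := by
  simp_rw [setLIntegral_cube_eq]
  exact ((hh.comp measurable_snd).indicator (measurableSet_setOf_mem_cube t)).lintegral_prod_right'

lemma lintegral_eq_lintegral_average_cube {t : ℝ} (ht : 0 < t)
    {h : EuclideanSpace ℝ (Fin n) → ℝ≥0∞} (hh : Measurable h) :
    ∫⁻ y, h y = ∫⁻ x, (volume (cube x t))⁻¹ * ∫⁻ y in cube x t, h y := by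
  simp_rw [volume_cube _ ht.le]
  rw [lintegral_const_mul _ (measurable_setLIntegral_cube t hh)]
  simp_rw [setLIntegral_cube_eq]
  rw [lintegral_lintegral_swap (f := fun x y => {z : EuclideanSpace ℝ (Fin n) ×
      EuclideanSpace ℝ (Fin n) | z.2 ∈ cube z.1 t}.indicator (fun z => h z.2) (x, y))
    ((hh.comp measurable_snd).indicator (measurableSet_setOf_mem_cube t)).aemeasurable]
  have key : ∀ y : EuclideanSpace ℝ (Fin n),
      ∫⁻ x, {z : EuclideanSpace ℝ (Fin n) × EuclideanSpace ℝ (Fin n) |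
        z.2 ∈ cube z.1 t}.indicator (fun z => h z.2) (x, y) = ENNReal.ofReal (t ^ n) * h y := by
    intro y
    have : ∀ x, {z : EuclideanSpace ℝ (Fin n) × EuclideanSpace ℝ (Fin n) |
        z.2 ∈ cube z.1 t}.indicator (fun z => h z.2) (x, y) =
        (cube y t).indicator (fun _ => h y) x := by
      intro x
      by_cases hx : y ∈ cube x t
      · simp [hx, mem_cube_comm.mp hx]
      · simp [hx, mt mem_cube_comm.mp hx]
    simp_rw [this]
    rw [lintegral_indicator_const (measurableSet_cube y t), volume_cube y ht.le, mul_comm]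
  simp_rw [key]
  rw [lintegral_const_mul _ hh, ← mul_assoc, ENNReal.inv_mul_cancel, one_mul]
  · simpa using pow_pos ht n
  · exact ENNReal.ofReal_ne_top

/-- Hölder's inequality for slice norms. -/
lemma lintegral_mul_le_sliceNormE_mul_sliceNormE {t : ℝ} (ht : 0 < t) {p p' q q' : ℝ}
    (hp : p.HolderConjugate p') (hq : q.HolderConjugate q')
    {g h : EuclideanSpace ℝ (Fin n) → ℝ≥0∞} (hg : Measurable g) (hh : Measurable h) :
    ∫⁻ y, g y * h y ≤ sliceNormE p q t g * sliceNormE p' q' t h := by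
  have meas : ∀ {f : EuclideanSpace ℝ (Fin n) → ℝ≥0∞} {a b : ℝ}, Measurable f → Measurable fun x =>
      ((volume (cube x t))⁻¹ * ∫⁻ y in cube x t, f y ^ a) ^ b := by
    intro f a b hf
    simp_rw [volume_cube _ ht.le]
    exact ((measurable_setLIntegral_cube t (hf.pow_const a)).const_mul _).pow_const b
  rw [lintegral_eq_lintegral_average_cube ht (h := fun y => g y * h y) (hg.mul hh)]
  calc ∫⁻ x, (volume (cube x t))⁻¹ * ∫⁻ y in cube x t, g y * h y
      ≤ ∫⁻ x, ((volume (cube x t))⁻¹ * ∫⁻ y in cube x t, g y ^ p) ^ (1 / p) *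
          ((volume (cube x t))⁻¹ * ∫⁻ y in cube x t, h y ^ p') ^ (1 / p') := by
        refine lintegral_mono fun x => ?_
        have := ENNReal.lintegral_mul_le_Lp_mul_Lq
          ((volume (cube x t))⁻¹ • volume.restrict (cube x t)) hp hg.aemeasurable hh.aemeasurable
        simpa [lintegral_smul_measure] using this
    _ ≤ _ := by
        refine (ENNReal.lintegral_mul_le_Lp_mul_Lq volume hq (meas hg).aemeasurable
          (meas hh).aemeasurable).trans_eq ?_
        simp only [sliceNormE, ← ENNReal.rpow_mul, one_div_mul_eq_div]

lemma sliceNormE_mono {p q t : ℝ} (hp : 0 < p) (hq : 0 < q)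
    {g h : EuclideanSpace ℝ (Fin n) → ℝ≥0∞} (hgh : ∀ᵐ x, g x ≤ h x) :
    sliceNormE p q t g ≤ sliceNormE p q t h := by
  unfold sliceNormE
  refine ENNReal.rpow_le_rpow (lintegral_mono fun x => ENNReal.rpow_le_rpow ?_ (by positivity))
    (by positivity)
  refine mul_le_mul_right (lintegral_mono_ae (ae_restrict_of_ae ?_)) _
  filter_upwards [hgh] with y hy
  gcongr

lemma sliceNormE_indicator_le {p q t ρ : ℝ} (hp : 0 < p) (hq : 0 < q) (ht : 0 < t) (hρ : 0 < ρ)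
    {F : Set (EuclideanSpace ℝ (Fin n))} {x₀ : EuclideanSpace ℝ (Fin n)} (hF : F ⊆ cube x₀ ρ)
    (hFm : MeasurableSet F) :
    sliceNormE p q t (F.indicator 1) ≤
      ENNReal.ofReal ((ρ / max ρ t) ^ (n / p) * (2 * max ρ t) ^ (n / q)) := by
  set M := max ρ t with hM
  have hM0 : 0 < M := lt_max_of_lt_left hρ
  have hbase : ∀ x, (volume (cube x t))⁻¹ * ∫⁻ y in cube x t, (F.indicator 1 y : ℝ≥0∞) ^ p ≤
      (cube x₀ (2 * M)).indicator (fun _ => ENNReal.ofReal ((ρ / M) ^ n)) x := by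
    intro x
    have h1 : ∀ y, (F.indicator 1 y : ℝ≥0∞) ^ p = F.indicator 1 y := by
      intro y
      by_cases hy : y ∈ F <;> simp [hy, hp]
    simp_rw [h1]
    rw [lintegral_indicator_one hFm, Measure.restrict_apply hFm]
    by_cases hx : x ∈ cube x₀ (2 * M)
    · rw [Set.indicator_of_mem hx, volume_cube _ ht.le, ← ENNReal.ofReal_inv_of_pos (pow_pos ht n)]
      have h2 : volume (F ∩ cube x t) ≤ ENNReal.ofReal ((min ρ t) ^ n) := by
        rcases le_total ρ t with h | h
        · rw [min_eq_left h, ← volume_cube x₀ hρ.le]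
          exact measure_mono (Set.inter_subset_left.trans hF)
        · rw [min_eq_right h, ← volume_cube x ht.le]
          exact measure_mono Set.inter_subset_right
      refine (mul_le_mul_right h2 _).trans ?_
      rw [← ENNReal.ofReal_mul (by positivity)]
      refine ENNReal.ofReal_le_ofReal (le_of_eq ?_)
      have h3 : min ρ t * M = ρ * t := min_mul_max ρ t
      have h4 : min ρ t = ρ * t / M := by rw [eq_div_iff hM0.ne', h3]
      rw [h4, ← inv_pow, ← mul_pow]
      congr 1
      field_simp
    · have : F ∩ cube x t = ∅ := by
        by_contra hne
        obtain ⟨y, hy1, hy2⟩ := Set.nonempty_iff_ne_empty.mpr hne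
        refine hx fun i => ?_
        have ha := hF hy1 i
        have hb := mem_cube_comm.mp hy2 i
        have hc := abs_sub_le (x i) (y i) (x₀ i)
        have := le_max_left ρ t
        have := le_max_right ρ t
        linarith
      simp [this]
  unfold sliceNormE
  have hqp : 0 < q / p := div_pos hq hp
  calc (∫⁻ x, ((volume (cube x t))⁻¹ *
          ∫⁻ y in cube x t, (F.indicator 1 y : ℝ≥0∞) ^ p) ^ (q / p)) ^ (1 / q)
      ≤ (∫⁻ x, (cube x₀ (2 * M)).indicator
          (fun _ => ENNReal.ofReal ((ρ / M) ^ n) ^ (q / p)) x) ^ (1 / q) := by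
        gcongr with x
        refine (ENNReal.rpow_le_rpow (hbase x) hqp.le).trans_eq ?_
        by_cases hx : x ∈ cube x₀ (2 * M) <;> simp [hx, hqp]
    _ = _ := by
        rw [lintegral_indicator_const (measurableSet_cube _ _), volume_cube _ (by positivity),
          ENNReal.mul_rpow_of_nonneg _ _ (by positivity), ← ENNReal.rpow_mul,
          ENNReal.ofReal_rpow_of_pos (by positivity), ENNReal.ofReal_rpow_of_pos (by positivity),
          ← ENNReal.ofReal_mul (by positivity), ← Real.rpow_natCast, ← Real.rpow_natCast,
          ← Real.rpow_mul (by positivity), ← Real.rpow_mul (by positivity)]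
        congr 3
        · congr 1
          field_simp
        · congr 1
          field_simp

end SliceNorms

section Median

/-- Every real measurable function on a finite measure space has a median. -/
lemma exists_median {X : Type*} [MeasurableSpace X] (μ : Measure X) [IsFiniteMeasure μ]
    {b : X → ℝ} (hb : Measurable b) :
    ∃ m : ℝ, μ Set.univ / 2 ≤ μ {x | b x ≤ m} ∧ μ Set.univ / 2 ≤ μ {x | m ≤ b x} := by
  rcases eq_or_ne μ 0 with rfl | hμ
  · exact ⟨0, by simp⟩
  set ν := μ.map b
  have hν : ν Set.univ = μ Set.univ := by
    rw [Measure.map_apply hb MeasurableSet.univ, Set.preimage_univ]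
  have hpos : 0 < ν Set.univ := by
    rw [hν]
    exact Measure.measure_univ_pos.mpr hμ
  suffices ∃ m : ℝ, ν Set.univ / 2 ≤ ν (Set.Iic m) ∧ ν Set.univ / 2 ≤ ν (Set.Ici m) by
    obtain ⟨m, h1, h2⟩ := this
    rw [hν, Measure.map_apply hb measurableSet_Iic] at h1
    rw [hν, Measure.map_apply hb measurableSet_Ici] at h2
    exact ⟨m, h1, h2⟩
  have hhalf : ν Set.univ / 2 < ν Set.univ :=
    ENNReal.half_lt_self hpos.ne' (measure_ne_top ν _)
  set S := {a : ℝ | ν Set.univ / 2 ≤ ν (Set.Iic a)} with hS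
  have hne : S.Nonempty :=
    (((tendsto_measure_Iic_atTop ν).eventually (lt_mem_nhds hhalf)).exists).imp fun a ha => ha.le
  have hbdd : BddBelow S := by
    have hbot : Filter.Tendsto (fun a : ℝ => ν (Set.Iic a)) Filter.atBot (nhds 0) := by
      have h := tendsto_measure_iInter_atBot (μ := ν) (s := fun a : ℝ => Set.Iic a)
        (fun a => measurableSet_Iic.nullMeasurableSet) (fun a c hac => Set.Iic_subset_Iic.mpr hac)
        ⟨0, measure_ne_top ν _⟩
      have hempty : ⋂ a : ℝ, Set.Iic a = ∅ := by
        simpa [Set.eq_empty_iff_forall_notMem] using exists_lt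
      rwa [hempty, measure_empty] at h
    have hlt : 0 < ν Set.univ / 2 := ENNReal.half_pos hpos.ne'
    obtain ⟨a, ha⟩ := (hbot.eventually (gt_mem_nhds hlt)).exists
    refine ⟨a, fun c hc => ?_⟩
    by_contra hca
    exact absurd (hc.trans (measure_mono (Set.Iic_subset_Iic.mpr (not_le.mp hca).le))) ha.not_ge
  refine ⟨sInf S, ?_, ?_⟩
  · obtain ⟨u, hu, hgt, hlim⟩ := exists_seq_strictAnti_tendsto (sInf S)
    have hI : Set.Iic (sInf S) = ⋂ k, Set.Iic (u k) := by
      ext z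
      simp only [Set.mem_Iic, Set.mem_iInter]
      exact ⟨fun h k => h.trans (hgt k).le, fun h => ge_of_tendsto' hlim h⟩
    have hanti : Antitone fun k => Set.Iic (u k) := fun i j hij =>
      Set.Iic_subset_Iic.mpr (hu.antitone hij)
    rw [hI, hanti.measure_iInter (fun k => measurableSet_Iic.nullMeasurableSet)
      ⟨0, measure_ne_top ν _⟩]
    refine le_iInf fun k => ?_
    obtain ⟨a, ha, hak⟩ := exists_lt_of_csInf_lt hne (hgt k)
    exact le_trans ha (measure_mono (Set.Iic_subset_Iic.mpr hak.le))
  · have hIio : ν (Set.Iio (sInf S)) ≤ ν Set.univ / 2 := by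
      obtain ⟨u, hu, hlt, hlim⟩ := exists_seq_strictMono_tendsto (sInf S)
      rw [← iUnion_Iic_eq_Iio_of_lt_of_tendsto hlt hlim]
      have hmono : Monotone fun k => Set.Iic (u k) := fun i j hij =>
        Set.Iic_subset_Iic.mpr (hu.monotone hij)
      rw [hmono.measure_iUnion]
      exact iSup_le fun k => (not_le.mp fun h => (notMem_of_lt_csInf (hlt k) hbdd) h).le
    rw [← Set.compl_Iio, measure_compl measurableSet_Iio (measure_ne_top ν _)]
    refine ENNReal.le_sub_of_add_le_left (measure_ne_top ν _) ?_
    calc ν (Set.Iio (sInf S)) + ν Set.univ / 2 ≤ ν Set.univ / 2 + ν Set.univ / 2 := by gcongr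
      _ = ν Set.univ := ENNReal.add_halves _

end Median

section Kernel

variable {n : ℕ}

/-- On cubes of side `ρ` displaced by `ρ • v`, the kernel `Ω(x - y) ‖x - y‖ ^ (α - n)` is continuous,
has constant sign `σ`, and has size at least a multiple of `ρ ^ (α - n)`. -/
lemma exists_kernel_lower_bound {α : ℝ} (hαn : α < n) {Ω : EuclideanSpace ℝ (Fin n) → ℝ}
    (hhom : HomogZero Ω) {U : Set (EuclideanSpace ℝ (Fin n))} (hU : IsOpen U)
    (hcont : ContinuousOn Ω U) {z₀ : EuclideanSpace ℝ (Fin n)} (hz₀U : z₀ ∈ U) (hz₀ : ‖z₀‖ = 1)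
    (hΩ : Ω z₀ ≠ 0) :
    ∃ (σ κ : ℝ) (v : EuclideanSpace ℝ (Fin n)), |σ| = 1 ∧ 0 < κ ∧
      ∀ (x₀ : EuclideanSpace ℝ (Fin n)) (ρ : ℝ), 0 < ρ → ∀ x ∈ cube x₀ ρ,
        ContinuousOn (fun y => Ω (x - y) * ‖x - y‖ ^ (α - n)) (cube (x₀ - ρ • v) ρ) ∧
        ∀ y ∈ cube (x₀ - ρ • v) ρ, κ * ρ ^ (α - n) ≤ σ * (Ω (x - y) * ‖x - y‖ ^ (α - n)) := by
  obtain ⟨σ, hσ, hσΩ⟩ : ∃ σ : ℝ, |σ| = 1 ∧ σ * Ω z₀ = |Ω z₀| := by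
    rcases lt_or_gt_of_ne hΩ with h | h
    · exact ⟨-1, by simp, by rw [abs_of_neg h]; ring⟩
    · exact ⟨1, by simp, by rw [abs_of_pos h]; ring⟩
  have hc : 0 < |Ω z₀| / 2 := half_pos (abs_pos.mpr hΩ)
  have hev : ∀ᶠ z in nhds z₀, z ∈ U ∧ |Ω z₀| / 2 < σ * Ω z := by
    refine Filter.Eventually.and (hU.mem_nhds hz₀U) ?_
    have hca : ContinuousAt (fun z => σ * Ω z) z₀ :=
      (hcont.continuousAt (hU.mem_nhds hz₀U)).const_mul σ
    refine hca.eventually (lt_mem_nhds ?_)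
    exact (half_lt_self (abs_pos.mpr hΩ)).trans_eq hσΩ.symm
  obtain ⟨ε', hε', hball'⟩ := Metric.eventually_nhds_iff_ball.mp hev
  obtain ⟨ε, hε, hε2, hball⟩ : ∃ ε > 0, ε ≤ 1 / 2 ∧
      ∀ z ∈ ball z₀ ε, z ∈ U ∧ |Ω z₀| / 2 < σ * Ω z :=
    ⟨min ε' (1 / 2), by positivity, min_le_right _ _,
      fun z hz => hball' z (ball_subset_ball (min_le_left _ _) hz)⟩
  set L : ℝ := (n + 1) / ε with hL
  have hL0 : 0 < L := by positivity
  refine ⟨σ, |Ω z₀| / 2 * (2 * L) ^ (α - n), L • z₀, hσ, by positivity, ?_⟩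
  intro x₀ ρ hρ x hx
  have hLρ : 0 < L * ρ := by positivity
  have hz : ∀ y ∈ cube (x₀ - ρ • L • z₀) ρ, (L * ρ)⁻¹ • (x - y) ∈ ball z₀ ε := by
    intro y hy
    have hw : ‖(x - y) - (L * ρ) • z₀‖ ≤ n * ρ := by
      refine norm_le_of_forall_abs_le hρ.le fun i => ?_
      have h1 := hx i
      have h2 := hy i
      simp only [PiLp.sub_apply, PiLp.smul_apply, smul_eq_mul, abs_le] at h1 h2 ⊢
      constructor <;> nlinarith
    have heq : (L * ρ)⁻¹ • (x - y) - z₀ = (L * ρ)⁻¹ • ((x - y) - (L * ρ) • z₀) := by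
      rw [smul_sub _ (x - y), inv_smul_smul₀ hLρ.ne']
    rw [mem_ball, dist_eq_norm, heq, norm_smul, norm_inv, Real.norm_of_nonneg hLρ.le]
    calc (L * ρ)⁻¹ * ‖(x - y) - (L * ρ) • z₀‖ ≤ (L * ρ)⁻¹ * (n * ρ) := by gcongr
      _ = n * ε / (n + 1) := by
          rw [hL]
          field_simp
      _ < ε := by
          rw [div_lt_iff₀ (by positivity)]
          nlinarith
  have hnorm : ∀ y ∈ cube (x₀ - ρ • L • z₀) ρ, 0 < ‖x - y‖ ∧ ‖x - y‖ ≤ 2 * L * ρ := by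
    intro y hy
    have h1 := mem_ball_iff_norm.mp (hz y hy)
    have h2 : ‖(L * ρ)⁻¹ • (x - y)‖ = (L * ρ)⁻¹ * ‖x - y‖ := by
      rw [norm_smul, norm_inv, Real.norm_of_nonneg hLρ.le]
    have h3 := norm_sub_norm_le z₀ ((L * ρ)⁻¹ • (x - y))
    have h4 := norm_sub_norm_le ((L * ρ)⁻¹ • (x - y)) z₀
    rw [norm_sub_rev] at h3
    rw [h2, hz₀] at h3 h4
    have h5 : 0 < (L * ρ)⁻¹ * ‖x - y‖ := by linarith
    have h6 : (L * ρ)⁻¹ * ‖x - y‖ ≤ 2 := by linarith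
    rw [inv_mul_le_iff₀ hLρ] at h6
    exact ⟨pos_of_mul_pos_right h5 (by positivity), by linarith⟩
  have hΩeq : ∀ y ∈ cube (x₀ - ρ • L • z₀) ρ, Ω (x - y) = Ω ((L * ρ)⁻¹ • (x - y)) := fun y hy =>
    (hhom _ (by positivity) _ (norm_pos_iff.mp (hnorm y hy).1)).symm
  refine ⟨ContinuousOn.mul ?_ ?_, ?_⟩
  · refine ContinuousOn.congr ?_ hΩeq
    exact hcont.comp (by fun_prop) fun y hy => (hball _ (hz y hy)).1
  · exact ContinuousOn.rpow_const (by fun_prop) fun y hy => Or.inl (hnorm y hy).1.ne'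
  · intro y hy
    have h1 : |Ω z₀| / 2 ≤ σ * Ω (x - y) := by
      rw [hΩeq y hy]
      exact (hball _ (hz y hy)).2.le
    have h2 : (2 * L) ^ (α - n) * ρ ^ (α - n) ≤ ‖x - y‖ ^ (α - n) := by
      rw [← Real.mul_rpow (by positivity) hρ.le]
      exact Real.rpow_le_rpow_of_nonpos (hnorm y hy).1 (hnorm y hy).2 (by linarith)
    calc |Ω z₀| / 2 * (2 * L) ^ (α - n) * ρ ^ (α - n)
        = |Ω z₀| / 2 * ((2 * L) ^ (α - n) * ρ ^ (α - n)) := by ring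
      _ ≤ σ * Ω (x - y) * ‖x - y‖ ^ (α - n) := by
          have h3 := hc.le.trans h1
          gcongr
      _ = _ := by ring

lemma mul_sub_le_abs_commutatorOp {α κ σ m ρ : ℝ} {Ω b : EuclideanSpace ℝ (Fin n) → ℝ}
    (hσ : |σ| = 1) (hκ : 0 ≤ κ) {K F : Set (EuclideanSpace ℝ (Fin n))} (hK : IsCompact K)
    (hFK : F ⊆ K) (hF : MeasurableSet F) (hb : LocallyIntegrable b volume)
    {x : EuclideanSpace ℝ (Fin n)}
    (hcont : ContinuousOn (fun y => Ω (x - y) * ‖x - y‖ ^ (α - n)) K)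
    (hlow : ∀ y ∈ K, κ ≤ σ * (Ω (x - y) * ‖x - y‖ ^ (α - n)))
    (hFm : ∀ y ∈ F, b y ≤ m) (hρ : ρ ≤ volume.real F) (hx : m ≤ b x) :
    κ * ρ * (b x - m) ≤ |commutatorOp Ω α b (F.indicator 1) x| := by
  set k := fun y => Ω (x - y) * ‖x - y‖ ^ (α - n) with hk
  have hkF : IntegrableOn k F := (hcont.integrableOn_compact hK).mono_set hFK
  have hkbF : IntegrableOn (fun y => k y * b y) F :=
    (IntegrableOn.continuousOn_mul hcont (hb.integrableOn_isCompact hK) hK).mono_set hFK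
  have hFfin : volume F ≠ ∞ := ((measure_mono hFK).trans_lt hK.measure_lt_top).ne
  have h1 : fracInt Ω α (F.indicator 1) x = ∫ y in F, k y := by
    rw [← integral_indicator hF]
    refine integral_congr_ae (.of_forall fun y => ?_)
    by_cases hy : y ∈ F <;> simp [hy, hk]
  have h2 : fracInt Ω α (fun y => b y * F.indicator 1 y) x = ∫ y in F, k y * b y := by
    rw [← integral_indicator hF]
    refine integral_congr_ae (.of_forall fun y => ?_)
    by_cases hy : y ∈ F <;> simp [hy, hk]
  have hint : IntegrableOn (fun y => σ * (b x * k y - k y * b y)) F :=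
    ((hkF.const_mul (b x)).sub hkbF).const_mul σ
  have h3 : σ * commutatorOp Ω α b (F.indicator 1) x =
      ∫ y in F, σ * (b x * k y - k y * b y) := by
    rw [integral_const_mul, integral_sub (hkF.const_mul (b x)) hkbF, integral_const_mul, ← h1, ← h2]
    rfl
  calc κ * ρ * (b x - m) ≤ κ * volume.real F * (b x - m) := by
        have : 0 ≤ b x - m := sub_nonneg.mpr hx
        gcongr
    _ = ∫ _y in F, κ * (b x - m) := by
        rw [setIntegral_const, smul_eq_mul]
        ring
    _ ≤ ∫ y in F, σ * (b x * k y - k y * b y) := by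
        refine setIntegral_mono_on (integrableOn_const hFfin) hint hF fun y hy => ?_
        calc κ * (b x - m) ≤ (σ * k y) * (b x - b y) := by
              have h4 := hlow y (hFK hy)
              have h5 := hFm y hy
              have h6 : 0 ≤ b x - m := sub_nonneg.mpr hx
              exact mul_le_mul h4 (by linarith) h6 (hκ.trans h4)
          _ = _ := by ring
    _ = σ * commutatorOp Ω α b (F.indicator 1) x := h3.symm
    _ ≤ |commutatorOp Ω α b (F.indicator 1) x| := by
        refine (le_abs_self _).trans_eq ?_
        rw [abs_mul, hσ, one_mul]

end Kernel

section Oscillation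

variable {n : ℕ}

lemma commutatorOp_neg (Ω : EuclideanSpace ℝ (Fin n) → ℝ) (α : ℝ)
    (b f : EuclideanSpace ℝ (Fin n) → ℝ) (x : EuclideanSpace ℝ (Fin n)) :
    commutatorOp Ω α (fun y => -b y) f x = -commutatorOp Ω α b f x := by
  simp only [commutatorOp, fracInt, neg_mul, mul_neg, integral_neg]
  ring

lemma setLIntegral_sub_le {α β : ℝ} (hn : 1 ≤ n) {p q r s t : ℝ} (hp1 : 1 < p) (hpr : p < r)
    (hq1 : 1 < q) (hqs : q < s) (hpr' : (α + β) / n = 1 / p - 1 / r)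
    (hqs' : (α + β) / n = 1 / q - 1 / s) (ht : 0 < t) {Ω b : EuclideanSpace ℝ (Fin n) → ℝ}
    {σ κ : ℝ} {v : EuclideanSpace ℝ (Fin n)} (hσ : |σ| = 1) (hκ : 0 < κ)
    (hker : ∀ (x₀ : EuclideanSpace ℝ (Fin n)) (ρ : ℝ), 0 < ρ → ∀ x ∈ cube x₀ ρ,
        ContinuousOn (fun y => Ω (x - y) * ‖x - y‖ ^ (α - n)) (cube (x₀ - ρ • v) ρ) ∧
        ∀ y ∈ cube (x₀ - ρ • v) ρ, κ * ρ ^ (α - n) ≤ σ * (Ω (x - y) * ‖x - y‖ ^ (α - n)))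
    (hbm : Measurable b) (hb : LocallyIntegrable b volume) {C₀ : ℝ} (hC₀ : 0 ≤ C₀)
    (hbdd : ∀ f : EuclideanSpace ℝ (Fin n) → ℝ, MemSlice p q t f →
        sliceNorm r s t (commutatorOp Ω α b f) ≤ ENNReal.ofReal C₀ * sliceNorm p q t f)
    (x₀ : EuclideanSpace ℝ (Fin n)) {ρ : ℝ} (hρ : 0 < ρ) {m : ℝ}
    (hm : volume (cube (x₀ - ρ • v) ρ) / 2 ≤ volume ({y | b y ≤ m} ∩ cube (x₀ - ρ • v) ρ)) :
    ∫⁻ x in cube x₀ ρ, ENNReal.ofReal (b x - m) ≤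
      ENNReal.ofReal (2 ^ (n + α + β + 1) / κ * C₀ * ρ ^ (n + β)) := by
  have hn0 : (0 : ℝ) < n := by exact_mod_cast hn
  have hp0 : 0 < p := by linarith
  have hq0 : 0 < q := by linarith
  have hr := Real.HolderConjugate.conjExponent (hp1.trans hpr)
  have hs := Real.HolderConjugate.conjExponent (hq1.trans hqs)
  set r' := r.conjExponent
  set s' := s.conjExponent
  set K := cube (x₀ - ρ • v) ρ with hK
  set F := {y | b y ≤ m} ∩ K with hFdef
  have hFK : F ⊆ K := Set.inter_subset_right
  have hF : MeasurableSet F :=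
    (measurableSet_le hbm measurable_const).inter (measurableSet_cube _ _)
  have hFreal : ρ ^ n / 2 ≤ volume.real F := by
    have hFfin : volume F ≠ ∞ :=
      ((measure_mono hFK).trans_lt (isCompact_cube _ hρ.le).measure_lt_top).ne
    rw [hK, volume_cube _ hρ.le] at hm
    have h := ENNReal.toReal_mono hFfin hm
    rwa [ENNReal.toReal_div, ENNReal.toReal_ofReal (by positivity), ENNReal.toReal_ofNat] at h
  set a := κ * ρ ^ (α - n) * (ρ ^ n / 2) with ha
  have ha0 : 0 < a := by positivity
  set M := max ρ t
  have hM0 : 0 < M := lt_max_of_lt_left hρ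
  have hslice1 : sliceNorm p q t (F.indicator 1) ≤
      ENNReal.ofReal ((ρ / M) ^ (n / p) * (2 * M) ^ (n / q)) := by
    refine le_trans (le_of_eq ?_) (sliceNormE_indicator_le hp0 hq0 ht hρ hFK hF)
    unfold sliceNorm
    congr 1
    ext y
    by_cases hy : y ∈ F <;> simp [hy]
  have hcomm := (hbdd _ ⟨measurable_one.indicator hF,
    (hslice1.trans_lt ENNReal.ofReal_lt_top).ne⟩).trans (mul_le_mul_right hslice1 _)
  set h : EuclideanSpace ℝ (Fin n) → ℝ≥0∞ :=
    (cube x₀ ρ).indicator fun x => ENNReal.ofReal a * ENNReal.ofReal (b x - m) with hh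
  have hhm : Measurable h :=
    ((hbm.sub_const m).ennreal_ofReal.const_mul _).indicator (measurableSet_cube _ _)
  have hle : ∀ x, h x ≤ ENNReal.ofReal |commutatorOp Ω α b (F.indicator 1) x| := by
    intro x
    by_cases hx : x ∈ cube x₀ ρ
    · rw [hh, Set.indicator_of_mem hx, ← ENNReal.ofReal_mul ha0.le]
      rcases le_total m (b x) with hmx | hmx
      · exact ENNReal.ofReal_le_ofReal <| mul_sub_le_abs_commutatorOp hσ (by positivity)
          (isCompact_cube _ hρ.le) hFK hF hb (hker x₀ ρ hρ x hx).1 (hker x₀ ρ hρ x hx).2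
          (fun y hy => hy.1) hFreal hmx
      · rw [ENNReal.ofReal_of_nonpos (mul_nonpos_of_nonneg_of_nonpos ha0.le (by linarith))]
        exact zero_le
    · simp [hh, hx]
  have hhol : ENNReal.ofReal a * ∫⁻ x in cube x₀ ρ, ENNReal.ofReal (b x - m) ≤
      sliceNormE r s t h * sliceNormE r' s' t ((cube x₀ ρ).indicator 1) := by
    refine le_trans (le_of_eq ?_) (lintegral_mul_le_sliceNormE_mul_sliceNormE ht hr hs hhm
      (measurable_one.indicator (measurableSet_cube x₀ ρ)))
    rw [← lintegral_const_mul _ (hbm.sub_const m).ennreal_ofReal,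
      ← lintegral_indicator (measurableSet_cube x₀ ρ)]
    congr 1
    ext x
    by_cases hx : x ∈ cube x₀ ρ <;> simp [hh, hx]
  have hN : ((ρ / M) ^ (n / p) * (2 * M) ^ (n / q)) * ((ρ / M) ^ (n / r') * (2 * M) ^ (n / s')) =
      (2 * ρ) ^ (n + α + β) := by
    have e1 : n / p + n / r' = n + α + β := by
      have h1 := hr.inv_add_inv_eq_one
      have h2 : α + β = n * (1 / p - 1 / r) := by
        rw [← hpr']
        field_simp
      have h3 : r'⁻¹ = 1 - r⁻¹ := by linarith
      rw [add_assoc, h2, div_eq_mul_inv _ r', h3]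
      ring
    have e2 : n / q + n / s' = n + α + β := by
      have h1 := hs.inv_add_inv_eq_one
      have h2 : α + β = n * (1 / q - 1 / s) := by
        rw [← hqs']
        field_simp
      have h3 : s'⁻¹ = 1 - s⁻¹ := by linarith
      rw [add_assoc, h2, div_eq_mul_inv _ s', h3]
      ring
    rw [mul_mul_mul_comm, ← Real.rpow_add (by positivity), ← Real.rpow_add (by positivity), e1, e2,
      ← Real.mul_rpow (by positivity) (by positivity)]
    congr 1
    field_simp
  have hfinal : ENNReal.ofReal a * ∫⁻ x in cube x₀ ρ, ENNReal.ofReal (b x - m) ≤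
      ENNReal.ofReal (C₀ * (2 * ρ) ^ (n + α + β)) := by
    calc _ ≤ sliceNormE r s t h * sliceNormE r' s' t ((cube x₀ ρ).indicator 1) := hhol
      _ ≤ ENNReal.ofReal C₀ * ENNReal.ofReal ((ρ / M) ^ (n / p) * (2 * M) ^ (n / q)) *
          ENNReal.ofReal ((ρ / M) ^ (n / r') * (2 * M) ^ (n / s')) := by
        refine mul_le_mul' ((sliceNormE_mono hr.pos hs.pos (.of_forall hle)).trans hcomm) ?_
        exact sliceNormE_indicator_le hr.symm.pos hs.symm.pos ht hρ subset_rfl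
          (measurableSet_cube _ _)
      _ = _ := by
        rw [mul_assoc, ← ENNReal.ofReal_mul (by positivity), hN, ← ENNReal.ofReal_mul hC₀]
  rw [mul_comm, ← ENNReal.le_div_iff_mul_le (Or.inl (by simpa using ha0))
    (Or.inl ENNReal.ofReal_ne_top), ← ENNReal.ofReal_div_of_pos ha0] at hfinal
  refine hfinal.trans_eq (congrArg _ ?_)
  have e3 : a = κ * ρ ^ α / 2 := by
    rw [ha, Real.rpow_sub_natCast hρ.ne']
    field_simp
  rw [e3, Real.mul_rpow (by norm_num) hρ.le, Real.rpow_add_one (by norm_num),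
    show (n : ℝ) + α + β = (n + β) + α by ring, Real.rpow_add hρ (n + β)]
  have := Real.rpow_pos_of_pos hρ α
  field_simp

lemma ofReal_abs_setAvg_sub_mul_volume_le {b : EuclideanSpace ℝ (Fin n) → ℝ}
    {S : Set (EuclideanSpace ℝ (Fin n))} (hb : IntegrableOn b S) (hS0 : volume S ≠ 0)
    (hS : volume S ≠ ∞) (c : ℝ) :
    ENNReal.ofReal |setAvg S b - c| * volume S ≤ ∫⁻ y in S, ENNReal.ofReal |b y - c| := by
  have hpos : 0 < (volume S).toReal := ENNReal.toReal_pos hS0 hS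
  have h1 : ∫ y in S, (b y - c) = (setAvg S b - c) * (volume S).toReal := by
    rw [integral_sub hb (integrableOn_const hS), setIntegral_const, setAvg, smul_eq_mul,
      Measure.real]
    field_simp
  have h2 := enorm_integral_le_lintegral_enorm (μ := volume.restrict S) fun y => b y - c
  simp only [Real.enorm_eq_ofReal_abs, h1, abs_mul, abs_of_pos hpos] at h2
  rwa [ENNReal.ofReal_mul (abs_nonneg _), ENNReal.ofReal_toReal hS] at h2

lemma setLIntegral_abs_sub_setAvg_le {b : EuclideanSpace ℝ (Fin n) → ℝ}
    (hb : LocallyIntegrable b volume) (x : EuclideanSpace ℝ (Fin n)) {ρ : ℝ} (hρ : 0 < ρ) {c D : ℝ}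
    (hD : 0 ≤ D) (h : ∫⁻ y in cube x ρ, ENNReal.ofReal |b y - c| ≤ ENNReal.ofReal D) :
    ∫⁻ y in cube x ρ, ENNReal.ofReal |b y - setAvg (cube x ρ) b| ≤ ENNReal.ofReal (2 * D) := by
  calc ∫⁻ y in cube x ρ, ENNReal.ofReal |b y - setAvg (cube x ρ) b|
      ≤ ∫⁻ y in cube x ρ,
          (ENNReal.ofReal |b y - c| + ENNReal.ofReal |setAvg (cube x ρ) b - c|) := by
        refine lintegral_mono fun y => ?_
        rw [← ENNReal.ofReal_add (abs_nonneg _) (abs_nonneg _), abs_sub_comm (setAvg _ _) c]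
        exact ENNReal.ofReal_le_ofReal (abs_sub_le _ _ _)
    _ = (∫⁻ y in cube x ρ, ENNReal.ofReal |b y - c|) +
          ENNReal.ofReal |setAvg (cube x ρ) b - c| * volume (cube x ρ) := by
        rw [lintegral_add_right _ measurable_const, setLIntegral_const]
    _ ≤ ENNReal.ofReal D + ENNReal.ofReal D := by
        refine add_le_add h (le_trans ?_ h)
        exact ofReal_abs_setAvg_sub_mul_volume_le
          (hb.integrableOn_isCompact (isCompact_cube x hρ.le)) (volume_cube_ne_zero x hρ)
          (volume_cube_ne_top x hρ.le) c
    _ = ENNReal.ofReal (2 * D) := by rw [← ENNReal.ofReal_add hD hD, two_mul]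

lemma setLIntegral_abs_sub_setAvg_le_of_commutatorOp {α β : ℝ} (hn : 1 ≤ n) {p q r s t : ℝ}
    (hp1 : 1 < p) (hpr : p < r) (hq1 : 1 < q) (hqs : q < s)
    (hpr' : (α + β) / n = 1 / p - 1 / r)
    (hqs' : (α + β) / n = 1 / q - 1 / s) (ht : 0 < t) {Ω b : EuclideanSpace ℝ (Fin n) → ℝ}
    {σ κ : ℝ} {v : EuclideanSpace ℝ (Fin n)} (hσ : |σ| = 1) (hκ : 0 < κ)
    (hker : ∀ (x₀ : EuclideanSpace ℝ (Fin n)) (ρ : ℝ), 0 < ρ → ∀ x ∈ cube x₀ ρ,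
        ContinuousOn (fun y => Ω (x - y) * ‖x - y‖ ^ (α - n)) (cube (x₀ - ρ • v) ρ) ∧
        ∀ y ∈ cube (x₀ - ρ • v) ρ, κ * ρ ^ (α - n) ≤ σ * (Ω (x - y) * ‖x - y‖ ^ (α - n)))
    (hbm : Measurable b) (hb : LocallyIntegrable b volume) {C₀ : ℝ} (hC₀ : 0 ≤ C₀)
    (hbdd : ∀ f : EuclideanSpace ℝ (Fin n) → ℝ, MemSlice p q t f →
        sliceNorm r s t (commutatorOp Ω α b f) ≤ ENNReal.ofReal C₀ * sliceNorm p q t f)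
    (x₀ : EuclideanSpace ℝ (Fin n)) {ρ : ℝ} (hρ : 0 < ρ) :
    ∫⁻ x in cube x₀ ρ, ENNReal.ofReal |b x - setAvg (cube x₀ ρ) b| ≤
      ENNReal.ofReal (4 * (2 ^ (n + α + β + 1) / κ) * C₀ * ρ ^ (n + β)) := by
  have : IsFiniteMeasure (volume.restrict (cube (x₀ - ρ • v) ρ)) :=
    ⟨by simpa using (isCompact_cube _ hρ.le).measure_lt_top⟩
  obtain ⟨m, hm1, hm2⟩ := exists_median (volume.restrict (cube (x₀ - ρ • v) ρ)) hbm
  rw [Measure.restrict_apply_univ,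
    Measure.restrict_apply (measurableSet_le hbm measurable_const)] at hm1
  rw [Measure.restrict_apply_univ,
    Measure.restrict_apply (measurableSet_le measurable_const hbm)] at hm2
  have h1 := setLIntegral_sub_le hn hp1 hpr hq1 hqs hpr' hqs' ht hσ hκ hker hbm hb hC₀ hbdd x₀ hρ
    hm1
  have h2 := setLIntegral_sub_le (b := fun y => -b y) (m := -m) hn hp1 hpr hq1 hqs hpr' hqs' ht hσ
    hκ hker hbm.neg hb.neg hC₀ (fun f hf => by
      simpa only [sliceNorm, commutatorOp_neg, abs_neg] using hbdd f hf) x₀ hρ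
    (by simpa only [neg_le_neg_iff] using hm2)
  set D := 2 ^ (n + α + β + 1) / κ * C₀ * ρ ^ (n + β) with hD
  have hD0 : 0 ≤ D := by positivity
  refine (setLIntegral_abs_sub_setAvg_le hb x₀ hρ (c := m) (D := 2 * D) (by positivity) ?_).trans_eq
    (by congr 1; rw [hD]; ring)
  calc ∫⁻ y in cube x₀ ρ, ENNReal.ofReal |b y - m|
      = ∫⁻ y in cube x₀ ρ, (ENNReal.ofReal (b y - m) + ENNReal.ofReal (-b y - -m)) := by
        refine lintegral_congr fun y => ?_
        rcases le_total m (b y) with hy | hy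
        · rw [abs_of_nonneg (by linarith), ENNReal.ofReal_of_nonpos (p := -b y - -m) (by linarith),
            add_zero]
        · rw [abs_of_nonpos (by linarith), ENNReal.ofReal_of_nonpos (p := b y - m) (by linarith),
            zero_add]
          congr 1
          ring
    _ ≤ ENNReal.ofReal D + ENNReal.ofReal D := by
        rw [lintegral_add_left (hbm.sub_const m).ennreal_ofReal]
        exact add_le_add h1 h2
    _ = ENNReal.ofReal (2 * D) := by rw [← ENNReal.ofReal_add hD0 hD0, two_mul]

end Oscillation

section Campanato

variable {n : ℕ}

lemma abs_setAvg_sub_setAvg_cube_le {b : EuclideanSpace ℝ (Fin n) → ℝ} {β D : ℝ} (hD : 0 ≤ D)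
    (hb : LocallyIntegrable b volume)
    (hosc : ∀ (x : EuclideanSpace ℝ (Fin n)) (ρ : ℝ), 0 < ρ →
      ∫⁻ y in cube x ρ, ENNReal.ofReal |b y - setAvg (cube x ρ) b| ≤
        ENNReal.ofReal (D * ρ ^ (n + β)))
    {x : EuclideanSpace ℝ (Fin n)} {ρ w : ℝ} (hρ : 0 < ρ) (hw : 0 < w)
    {S : Set (EuclideanSpace ℝ (Fin n))} (hS : S ⊆ cube x ρ)
    (hvol : ENNReal.ofReal (w * ρ ^ n) ≤ volume S) :
    |setAvg S b - setAvg (cube x ρ) b| ≤ D / w * ρ ^ β := by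
  have hSfin : volume S ≠ ∞ := ((measure_mono hS).trans_lt
    (isCompact_cube x hρ.le).measure_lt_top).ne
  have hpos : 0 < w * ρ ^ n := by positivity
  have hS0 : volume S ≠ 0 := ((ENNReal.ofReal_pos.mpr hpos).trans_le hvol).ne'
  have hbS : IntegrableOn b S :=
    (hb.integrableOn_isCompact (isCompact_cube x hρ.le)).mono_set hS
  have h := (mul_le_mul_right hvol _).trans <|
    (ofReal_abs_setAvg_sub_mul_volume_le hbS hS0 hSfin (setAvg (cube x ρ) b)).trans <|
    (lintegral_mono_set hS).trans (hosc x ρ hρ)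
  rw [← ENNReal.ofReal_mul (abs_nonneg _), ENNReal.ofReal_le_ofReal_iff (by positivity),
    ← le_div_iff₀ hpos] at h
  refine h.trans_eq ?_
  rw [Real.rpow_add hρ, Real.rpow_natCast]
  field_simp

lemma abs_setAvg_cube_sub_setAvg_cube_le {b : EuclideanSpace ℝ (Fin n) → ℝ} {β D : ℝ} (hD : 0 ≤ D)
    (hb : LocallyIntegrable b volume)
    (hosc : ∀ (x : EuclideanSpace ℝ (Fin n)) (ρ : ℝ), 0 < ρ →
      ∫⁻ y in cube x ρ, ENNReal.ofReal |b y - setAvg (cube x ρ) b| ≤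
        ENNReal.ofReal (D * ρ ^ (n + β)))
    {x y : EuclideanSpace ℝ (Fin n)} {ρ : ℝ} (hρ : 0 < ρ) (hS : cube y (ρ / 2) ⊆ cube x ρ) :
    |setAvg (cube y (ρ / 2)) b - setAvg (cube x ρ) b| ≤ D * 2 ^ n * ρ ^ β := by
  have := abs_setAvg_sub_setAvg_cube_le (w := (1 / 2) ^ n) hD hb hosc hρ (by positivity) hS (by
    rw [volume_cube y (by positivity), ← mul_pow]
    exact le_of_eq (by ring_nf))
  simpa using this

lemma ae_abs_sub_setAvg_cube_le {b : EuclideanSpace ℝ (Fin n) → ℝ} {β D : ℝ} (hβ : 0 < β)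
    (hD : 0 ≤ D) (hb : LocallyIntegrable b volume)
    (hosc : ∀ (x : EuclideanSpace ℝ (Fin n)) (ρ : ℝ), 0 < ρ →
      ∫⁻ y in cube x ρ, ENNReal.ofReal |b y - setAvg (cube x ρ) b| ≤
        ENNReal.ofReal (D * ρ ^ (n + β))) :
    ∀ᵐ x, ∀ ρ : ℝ, 0 < ρ →
      |setAvg (cube x ρ) b - b x| ≤ D * 2 ^ n / (1 - (1 / 2) ^ β) * ρ ^ β := by
  filter_upwards [IsUnifLocDoublingMeasure.ae_tendsto_average volume hb 1] with x hx ρ hρ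
  have hhalf : (1 / 2 : ℝ) ^ β < 1 := Real.rpow_lt_one (by norm_num) (by norm_num) hβ
  have hρk : ∀ k : ℕ, 0 < ρ / 2 ^ k := fun k => by positivity
  have hlim0 : Filter.Tendsto (fun k : ℕ => ρ / 2 ^ k) Filter.atTop (nhds 0) :=
    tendsto_const_nhds.div_atTop (tendsto_pow_atTop_atTop_of_one_lt one_lt_two)
  have hball : Filter.Tendsto (fun k : ℕ => setAvg (closedBall x (ρ / 2 ^ k / 2)) b) Filter.atTop
      (nhds (b x)) := by
    have h := hx (l := Filter.atTop) (fun _ : ℕ => x) (fun k : ℕ => ρ / 2 ^ k / 2)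
      (tendsto_nhdsWithin_iff.mpr ⟨by simpa using hlim0.div_const 2,
        .of_forall fun k => half_pos (hρk k)⟩)
      (.of_forall fun k => mem_closedBall_self (by have := hρk k; positivity))
    simp only [setAverage_eq, smul_eq_mul] at h
    exact h
  set w := (volume (closedBall (0 : EuclideanSpace ℝ (Fin n)) 1)).toReal with hw
  have hwfin : volume (closedBall (0 : EuclideanSpace ℝ (Fin n)) 1) ≠ ∞ :=
    measure_closedBall_lt_top.ne
  have hw0 : 0 < w := ENNReal.toReal_pos (measure_closedBall_pos _ _ one_pos).ne' hwfin
  have hdiff : Filter.Tendsto (fun k : ℕ => setAvg (closedBall x (ρ / 2 ^ k / 2)) b -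
      setAvg (cube x (ρ / 2 ^ k)) b) Filter.atTop (nhds 0) := by
    refine squeeze_zero_norm (a := fun k : ℕ => D / (w / 2 ^ n) * (ρ / 2 ^ k) ^ β) (fun k => ?_) ?_
    · refine abs_setAvg_sub_setAvg_cube_le hD hb hosc (hρk k) (by positivity)
        (closedBall_subset_cube _ _) (le_of_eq ?_)
      rw [Measure.addHaar_closedBall' volume x (by have := hρk k; positivity),
        ← ENNReal.ofReal_toReal hwfin, ← ENNReal.ofReal_mul (by have := hρk k; positivity),
        finrank_euclideanSpace_fin, ← hw]
      congr 1
      rw [div_pow _ 2]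
      ring
    · have h := (hlim0.rpow_const (Or.inr hβ.le) (p := β)).const_mul (D / (w / 2 ^ n))
      simpa [Real.zero_rpow hβ.ne'] using h
  have hcube : Filter.Tendsto (fun k : ℕ => setAvg (cube x (ρ / 2 ^ k)) b) Filter.atTop
      (nhds (b x)) := by
    simpa using hball.sub hdiff
  have hgeo := dist_le_of_le_geometric_of_tendsto₀ ((1 / 2 : ℝ) ^ β) (D * 2 ^ n * ρ ^ β) hhalf
    (fun k => ?_) hcube
  · rw [Real.dist_eq, pow_zero, div_one] at hgeo
    refine hgeo.trans_eq (by ring)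
  · rw [dist_comm, Real.dist_eq, pow_succ, ← div_div]
    refine (abs_setAvg_cube_sub_setAvg_cube_le hD hb hosc (hρk k)
      (cube_mono x (by have := hρk k; linarith))).trans_eq ?_
    rw [Real.div_rpow hρ.le (by positivity), ← Real.rpow_natCast 2 k, ← Real.rpow_mul two_pos.le,
      ← Real.rpow_natCast _ k, ← Real.rpow_mul (by norm_num), one_div, Real.inv_rpow two_pos.le,
      mul_comm β]
    ring

/-- A real function which is Hölder continuous on a set extends to a Hölder continuous function. -/
lemma exists_memLip_extension {β C : ℝ} (hβ0 : 0 < β) (hβ1 : β ≤ 1) (hC : 0 ≤ C)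
    {b : EuclideanSpace ℝ (Fin n) → ℝ} {A : Set (EuclideanSpace ℝ (Fin n))}
    (hb : ∀ x ∈ A, ∀ y ∈ A, |b x - b y| ≤ C * dist x y ^ β) :
    ∃ g, MemLip β g ∧ Set.EqOn b g A := by
  let b' : Snowflaking (EuclideanSpace ℝ (Fin n)) β hβ0 hβ1 → ℝ := fun z => b z.ofSnowflaking
  have hlip : LipschitzOnWith ⟨C, hC⟩ b' (Snowflaking.ofSnowflaking ⁻¹' A) := by
    refine LipschitzOnWith.of_dist_le_mul fun x hx y hy => ?_
    have h := hb _ hx _ hy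
    rwa [Snowflaking.dist_ofSnowflaking_ofSnowflaking,
      Real.rpow_inv_rpow dist_nonneg hβ0.ne'] at h
  obtain ⟨g, hg, hgeq⟩ := hlip.extend_real
  refine ⟨fun x => g (Snowflaking.toSnowflaking x), ⟨C, fun x y => ?_⟩, fun x hx => ?_⟩
  · have h := hg.dist_le_mul (Snowflaking.toSnowflaking x) (Snowflaking.toSnowflaking y)
    rwa [Snowflaking.dist_toSnowflaking_toSnowflaking] at h
  · exact hgeq (x := Snowflaking.toSnowflaking x) hx

/-- Campanato's characterization of Hölder continuity, one direction. -/
lemma exists_memLip_ae_eq {b : EuclideanSpace ℝ (Fin n) → ℝ} {β D : ℝ} (hβ0 : 0 < β) (hβ1 : β ≤ 1)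
    (hD : 0 ≤ D) (hb : LocallyIntegrable b volume)
    (hosc : ∀ (x : EuclideanSpace ℝ (Fin n)) (ρ : ℝ), 0 < ρ →
      ∫⁻ y in cube x ρ, ENNReal.ofReal |b y - setAvg (cube x ρ) b| ≤
        ENNReal.ofReal (D * ρ ^ (n + β))) :
    ∃ g : EuclideanSpace ℝ (Fin n) → ℝ, MemLip β g ∧ b =ᵐ[volume] g := by
  have hae := ae_abs_sub_setAvg_cube_le hβ0 hD hb hosc
  set B := D * 2 ^ n / (1 - (1 / 2 : ℝ) ^ β) with hB
  have hB0 : 0 ≤ B := by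
    have hhalf : (1 / 2 : ℝ) ^ β < 1 := Real.rpow_lt_one (by norm_num) (by norm_num) hβ0
    exact div_nonneg (by positivity) (by linarith)
  obtain ⟨g, hg, hgeq⟩ := exists_memLip_extension (b := b) hβ0 hβ1
    (C := (2 * B + D * 2 ^ n) * 4 ^ β) (by positivity)
    (A := {x | ∀ ρ : ℝ, 0 < ρ → |setAvg (cube x ρ) b - b x| ≤ B * ρ ^ β}) (by
      intro x hx y hy
      rcases eq_or_ne x y with rfl | hxy
      · simpa using by positivity
      have hd : 0 < dist x y := dist_pos.mpr hxy
      have h1 := hx (4 * dist x y) (by positivity)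
      have h2 := hy (4 * dist x y / 2) (by positivity)
      have h3 := abs_setAvg_cube_sub_setAvg_cube_le hD hb hosc (x := x) (y := y)
        (ρ := 4 * dist x y) (by positivity)
        (cube_subset_cube (abs_sub_apply_le_dist x y) (by linarith))
      have h4 : B * (4 * dist x y / 2) ^ β ≤ B * (4 * dist x y) ^ β := by
        gcongr
        linarith
      have h5 : (4 * dist x y) ^ β = 4 ^ β * dist x y ^ β :=
        Real.mul_rpow (by norm_num) hd.le
      calc |b x - b y| ≤ B * (4 * dist x y) ^ β + D * 2 ^ n * (4 * dist x y) ^ β +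
            B * (4 * dist x y) ^ β := by
            rw [abs_le] at h1 h2 h3 ⊢
            constructor <;> linarith
        _ = _ := by
            rw [h5]
            ring)
  exact ⟨g, hg, hae.mono fun x hx => hgeq hx⟩

end Campanato

section Congruence

variable {n : ℕ}

lemma commutatorOp_congr_ae {b b' : EuclideanSpace ℝ (Fin n) → ℝ} (h : b =ᵐ[volume] b')
    (Ω : EuclideanSpace ℝ (Fin n) → ℝ) (α : ℝ) (f : EuclideanSpace ℝ (Fin n) → ℝ) :
    commutatorOp Ω α b f =ᵐ[volume] commutatorOp Ω α b' f := by
  have hint : ∀ x, fracInt Ω α (fun y => b y * f y) x = fracInt Ω α (fun y => b' y * f y) x :=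
    fun x => integral_congr_ae (h.mono fun y hy => by simp only [hy])
  filter_upwards [h] with x hx
  simp only [commutatorOp, hint, hx]

lemma setLIntegral_abs_sub_setAvg_congr_ae {b b' : EuclideanSpace ℝ (Fin n) → ℝ}
    (h : b =ᵐ[volume] b') (Q : Set (EuclideanSpace ℝ (Fin n))) :
    ∫⁻ y in Q, ENNReal.ofReal |b y - setAvg Q b| =
      ∫⁻ y in Q, ENNReal.ofReal |b' y - setAvg Q b'| := by
  have hQ : b =ᵐ[volume.restrict Q] b' := ae_restrict_of_ae h
  have havg : setAvg Q b = setAvg Q b' := by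
    rw [setAvg, setAvg, integral_congr_ae hQ]
  rw [havg]
  exact lintegral_congr_ae (hQ.mono fun y hy => by simp only [hy])

end Congruence

theorem statement3 (n : ℕ) (hn : 1 ≤ n) (α β : ℝ) (hβ0 : 0 < β) (hβ1 : β < 1)
    (hα0 : 0 < α) (hαn : α < n) (hαβ : α + β < n)
    (p q r s : ℝ) (hp1 : 1 < p) (hpr : p < r) (hq1 : 1 < q) (hqs : q < s)
    (hpr' : (α + β) / n = 1 / p - 1 / r) (hqs' : (α + β) / n = 1 / q - 1 / s)
    (Ω : EuclideanSpace ℝ (Fin n) → ℝ) (hhom : HomogZero Ω) (hmean : MeanZeroOnSphere Ω)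
    (U : Set (EuclideanSpace ℝ (Fin n))) (hUopen : IsOpen U)
    (hUne : (U ∩ sphere (0 : EuclideanSpace ℝ (Fin n)) 1).Nonempty)
    (hsmooth : ContDiffOn ℝ (⊤ : ℕ∞) Ω U)
    (hnz : ∀ x ∈ U ∩ sphere (0 : EuclideanSpace ℝ (Fin n)) 1, Ω x ≠ 0)
    (t : ℝ) (ht : 0 < t) :
    ∃ C > (0 : ℝ), ∀ (b : EuclideanSpace ℝ (Fin n) → ℝ) (C₀ : ℝ), 0 ≤ C₀ →
      LocallyIntegrable b volume →
      (∀ f : EuclideanSpace ℝ (Fin n) → ℝ, MemSlice p q t f →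
        sliceNorm r s t (commutatorOp Ω α b f) ≤ ENNReal.ofReal C₀ * sliceNorm p q t f) →
      (∃ g : EuclideanSpace ℝ (Fin n) → ℝ, MemLip β g ∧ b =ᵐ[volume] g) ∧
      ∀ (x : EuclideanSpace ℝ (Fin n)) (ρ : ℝ), 0 < ρ →
        volume (cube x ρ) ^ (-(1 + β / n)) *
            ∫⁻ y in cube x ρ, ENNReal.ofReal |b y - setAvg (cube x ρ) b| ≤
          ENNReal.ofReal (C * C₀) := by
  obtain ⟨z₀, hz₀U, hz₀⟩ := hUne
  obtain ⟨σ, κ, v, hσ, hκ, hker⟩ := exists_kernel_lower_bound hαn hhom hUopen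
    hsmooth.continuousOn hz₀U (mem_sphere_zero_iff_norm.mp hz₀) (hnz z₀ ⟨hz₀U, hz₀⟩)
  refine ⟨4 * (2 ^ (n + α + β + 1) / κ), by positivity, fun b C₀ hC₀ hb hbdd => ?_⟩
  have hosc : ∀ (x : EuclideanSpace ℝ (Fin n)) (ρ : ℝ), 0 < ρ →
      ∫⁻ y in cube x ρ, ENNReal.ofReal |b y - setAvg (cube x ρ) b| ≤
        ENNReal.ofReal (4 * (2 ^ (n + α + β + 1) / κ) * C₀ * ρ ^ (n + β)) := by
    intro x ρ hρ
    have hmk := hb.aestronglyMeasurable.ae_eq_mk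
    rw [setLIntegral_abs_sub_setAvg_congr_ae hmk]
    refine setLIntegral_abs_sub_setAvg_le_of_commutatorOp hn hp1 hpr hq1 hqs hpr' hqs' ht hσ hκ hker
      hb.aestronglyMeasurable.measurable_mk
      ((locallyIntegrable_congr hmk).mp hb) hC₀ (fun f hf => ?_) x hρ
    refine (sliceNormE_mono (by linarith) (by linarith) ?_).trans (hbdd f hf)
    filter_upwards [commutatorOp_congr_ae hmk Ω α f] with y hy
    rw [hy]
  refine ⟨exists_memLip_ae_eq hβ0 hβ1.le (by positivity) hb hosc, fun x ρ hρ => ?_⟩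
  refine (mul_le_mul_right (hosc x ρ hρ) _).trans_eq ?_
  have hn0 : (n : ℝ) ≠ 0 := by
    have : n ≠ 0 := by omega
    exact_mod_cast this
  rw [volume_cube x hρ.le, ENNReal.ofReal_rpow_of_pos (by positivity),
    ← ENNReal.ofReal_mul (by positivity), ← Real.rpow_natCast, ← Real.rpow_mul hρ.le]
  congr 1
  have hexp : (n : ℝ) * -(1 + β / n) = -(n + β) := by field_simp
  rw [hexp, mul_comm, mul_assoc, ← Real.rpow_add hρ, add_neg_cancel, Real.rpow_zero, mul_one]

end
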